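/- For every nonnegative integer n, 4·b̅₅(10n+2) = a̅₅(2n+1) + 2·c₅(2n). -/

import Mathlib

open scoped BigOperators

/-- The q-Pochhammer infinite product `(a; q)_∞ = ∏_{k≥0} (1 - a q^k)`. -/
noncomputable def qpoch (a q : ℂ) : ℂ := ∏' k : ℕ, (1 - a * q ^ k)

/-- `φ(-q) = (q;q)_∞² / (q²;q²)_∞`. -/
noncomputable def phiNeg (q : ℂ) : ℂ := qpoch q q ^ 2 / qpoch (q ^ 2) (q ^ 2)

/-- `ψ(-q) = (q;q)_∞ (q⁴;q⁴)_∞ / (q²;q²)_∞`. -/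
noncomputable def psiNeg (q : ℂ) : ℂ :=
  qpoch q q * qpoch (q ^ 4) (q ^ 4) / qpoch (q ^ 2) (q ^ 2)


/-- The product `∏ (1 + c q^(a k + b))`. -/
noncomputable def pr (c q : ℂ) (a b : ℕ) : ℂ := ∏' k : ℕ, (1 + c * q ^ (a * k + b))

/-- Euler's product `(q; q)_∞`. -/
noncomputable def eu (q : ℂ) : ℂ := pr (-1) q 1 1

lemma qpoch_eq_eu (q : ℂ) : qpoch q q = eu q := by
  unfold qpoch eu pr
  congr 1; ext k; ring

lemma summable_pr (c : ℂ) {q : ℂ} (hq : ‖q‖ < 1) {a : ℕ} (ha : 0 < a) (b : ℕ) :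
    Summable (fun k : ℕ => ‖c * q ^ (a * k + b)‖) := by
  have h1 : ‖q ^ a‖ < 1 := by
    rw [norm_pow]; exact pow_lt_one₀ (norm_nonneg _) hq ha.ne'
  have h2 : Summable (fun k : ℕ => ‖c * q ^ b‖ * ‖q ^ a‖ ^ k) :=
    (summable_geometric_of_lt_one (norm_nonneg _) h1).mul_left _
  refine h2.congr fun k => ?_
  rw [← norm_pow, ← norm_mul]; congr 1; ring

lemma multipliable_pr (c : ℂ) {q : ℂ} (hq : ‖q‖ < 1) {a : ℕ} (ha : 0 < a) (b : ℕ) :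
    Multipliable (fun k : ℕ => 1 + c * q ^ (a * k + b)) :=
  multipliable_one_add_of_summable (summable_pr c hq ha b)

lemma pr_ne_zero {c : ℂ} (hc : ‖c‖ ≤ 1) {q : ℂ} (hq : ‖q‖ < 1) {a b : ℕ} (ha : 0 < a) (hb : 0 < b) :
    pr c q a b ≠ 0 := by
  refine tprod_one_add_ne_zero_of_summable (fun k h => ?_) (summable_pr c hq ha b)
  have h1 : c * q ^ (a * k + b) = -1 := by linear_combination h
  have h2 : ‖c * q ^ (a * k + b)‖ = 1 := by rw [h1]; simp
  rw [norm_mul, norm_pow] at h2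
  have h3 : ‖q‖ ^ (a * k + b) < 1 := pow_lt_one₀ (norm_nonneg _) hq (by omega)
  nlinarith [norm_nonneg c, pow_nonneg (norm_nonneg q) (a * k + b)]

lemma exists_divmod_equiv (m : ℕ) [NeZero m] :
    ∃ e : Fin m × ℕ ≃ ℕ, ∀ p : Fin m × ℕ, e p = p.2 * m + p.1 :=
  ⟨(Equiv.prodComm _ _).trans (Nat.divModEquiv m).symm, fun p => by simp [Nat.divModEquiv]⟩

lemma tprod_split (f : ℕ → ℂ) (hf : Summable (fun k => ‖f k‖)) (m : ℕ) [NeZero m] :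
    ∏' k, (1 + f k) = ∏ r : Fin m, ∏' k, (1 + f (k * m + r)) := by
  obtain ⟨e, he⟩ := exists_divmod_equiv m
  have hs : Summable (fun p : Fin m × ℕ => ‖f (e p)‖) :=
    (e.summable_iff (f := fun k : ℕ => ‖f k‖)).2 hf
  have hM := multipliable_one_add_of_summable hs
  have h1 : ∏' p : Fin m × ℕ, (1 + f (e p)) = ∏' k, (1 + f k) := e.tprod_eq (fun k => 1 + f k)
  have h2 : ∀ r : Fin m, Multipliable (fun k => 1 + f (e (r, k))) := fun r =>
    multipliable_one_add_of_summable (hs.comp_injective (Prod.mk_right_injective r))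
  rw [← h1, hM.tprod_prod' h2, tprod_fintype]
  simp only [he]

lemma pr_split (c : ℂ) {q : ℂ} (hq : ‖q‖ < 1) {a : ℕ} (ha : 0 < a) (b m : ℕ) [NeZero m] :
    pr c q a b = ∏ r : Fin m, pr c q (a * m) (a * r + b) := by
  unfold pr
  rw [tprod_split _ (summable_pr c hq ha b) m]
  refine Finset.prod_congr rfl fun r _ => ?_
  congr 1; ext k
  rw [show a * (k * m + r) + b = a * m * k + (a * r + b) by ring]

lemma pr_pow (c q : ℂ) (n a b : ℕ) : pr c (q ^ n) a b = pr c q (n * a) (n * b) := by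
  unfold pr
  congr 1; ext k; rw [← pow_mul]; congr 3; ring

lemma pr_mul_neg {q : ℂ} (hq : ‖q‖ < 1) {a : ℕ} (ha : 0 < a) (b : ℕ) :
    pr 1 q a b * pr (-1) q a b = pr (-1) q (2 * a) (2 * b) := by
  unfold pr
  rw [← (multipliable_pr 1 hq ha b).tprod_mul (multipliable_pr (-1) hq ha b)]
  congr 1; ext k
  have : 2 * a * k + 2 * b = (a * k + b) * 2 := by ring
  rw [this, pow_mul]; ring

lemma eu_pow (q : ℂ) (n : ℕ) : eu (q ^ n) = pr (-1) q n n := by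
  unfold eu; rw [pr_pow]; simp

lemma eu_ne_zero {q : ℂ} (hq : ‖q‖ < 1) : eu q ≠ 0 :=
  pr_ne_zero (by simp) hq one_pos one_pos

lemma pow_lt {q : ℂ} (hq : ‖q‖ < 1) {n : ℕ} (hn : n ≠ 0) : ‖q ^ n‖ < 1 := by
  rw [norm_pow]; exact pow_lt_one₀ (norm_nonneg _) hq hn

lemma pr_plus {q : ℂ} (hq : ‖q‖ < 1) : pr 1 q 1 1 = eu (q ^ 2) / eu q := by
  rw [eq_div_iff (eu_ne_zero hq), eu_pow]
  exact pr_mul_neg hq one_pos 1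

lemma pr_plus_odd {q : ℂ} (hq : ‖q‖ < 1) :
    pr 1 q 2 1 = eu (q ^ 2) ^ 2 / (eu q * eu (q ^ 4)) := by
  have h := pr_split 1 hq one_pos 1 2
  have h2 : pr 1 q 2 2 = eu (q ^ 4) / eu (q ^ 2) := by
    have := pr_plus (pow_lt hq two_ne_zero)
    rw [pr_pow] at this
    rw [this]; congr 2; ring
  simp only [Fin.prod_univ_two, pr_plus hq] at h
  norm_num at h
  rw [h2] at h
  have n1 := eu_ne_zero hq
  have n2 := eu_ne_zero (pow_lt hq two_ne_zero)
  have n4 := eu_ne_zero (pow_lt hq four_ne_zero)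
  field_simp at h ⊢
  linear_combination -h

lemma eu_neg {q : ℂ} (hq : ‖q‖ < 1) :
    eu (-q) = eu (q ^ 2) ^ 3 / (eu q * eu (q ^ 4)) := by
  have hq' : ‖-q‖ < 1 := by simpa using hq
  have h := pr_split (-1) hq' one_pos 1 2
  simp only [Fin.prod_univ_two] at h
  norm_num at h
  have h1 : pr (-1) (-q) 2 1 = pr 1 q 2 1 := by
    unfold pr; congr 1; ext k
    rw [Odd.neg_pow ⟨k, rfl⟩]; ring
  have h2 : pr (-1) (-q) 2 2 = eu (q ^ 2) := by
    rw [← eu_pow]; congr 1; ring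
  unfold eu at *
  rw [h, h1, h2]
  rw [pr_plus_odd hq]; unfold eu; ring

lemma pr_five {η : ℂ} (hη : 1 + η + η ^ 2 + η ^ 3 + η ^ 4 = 0) {q : ℂ} (hq : ‖q‖ < 1) {a : ℕ}
    (ha : 0 < a) (b : ℕ) :
    pr (-1) q a b * pr (-η) q a b * pr (-η ^ 2) q a b * pr (-η ^ 3) q a b * pr (-η ^ 4) q a b
      = pr (-1) q (5 * a) (5 * b) := by
  unfold pr
  have m := fun c => multipliable_pr c hq ha b
  rw [← (m _).tprod_mul (m _), ← ((m _).mul (m _)).tprod_mul (m _),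
    ← (((m _).mul (m _)).mul (m _)).tprod_mul (m _),
    ← ((((m _).mul (m _)).mul (m _)).mul (m _)).tprod_mul (m _)]
  congr 1; ext k
  have : 5 * a * k + 5 * b = (a * k + b) * 5 := by ring
  rw [this, pow_mul]
  generalize q ^ (a * k + b) = x
  have h5 : η ^ 5 = 1 := by linear_combination (η - 1) * hη
  have e : (1 + -1 * x) * (1 + -η * x) * (1 + -η ^ 2 * x) * (1 + -η ^ 3 * x) * (1 + -η ^ 4 * x)
      - (1 + -1 * x ^ 5) = 0 := by
    have h4 : η ^ 4 = -(1 + η + η ^ 2 + η ^ 3) := by linear_combination hη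
    ring_nf
    have h6 : η ^ 6 = η := by linear_combination η * h5
    have h7 : η ^ 7 = η ^ 2 := by linear_combination η ^ 2 * h5
    have h8 : η ^ 8 = η ^ 3 := by linear_combination η ^ 3 * h5
    have h9 : η ^ 9 = η ^ 4 := by linear_combination η ^ 4 * h5
    have h10 : η ^ 10 = 1 := by linear_combination (η ^ 5 + 1) * h5
    simp only [h10, h9, h8, h7, h6, h5, h4]
    ring
  linear_combination e

lemma eu_rot {ζ : ℂ} (h5 : ζ ^ 5 = 1) {q : ℂ} (hq : ‖q‖ < 1) :
    eu (ζ * q) = pr (-ζ) q 5 1 * pr (-ζ ^ 2) q 5 2 * pr (-ζ ^ 3) q 5 3 * pr (-ζ ^ 4) q 5 4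
      * pr (-1) q 5 5 := by
  have hz : ‖ζ‖ = 1 := by
    have : ‖ζ‖ ^ 5 = 1 := by rw [← norm_pow, h5]; simp
    exact (pow_eq_one_iff_of_nonneg (norm_nonneg _) (by norm_num)).1 this
  have hq' : ‖ζ * q‖ < 1 := by rw [norm_mul, hz, one_mul]; exact hq
  have h := pr_split (-1) hq' one_pos 1 5
  have key : ∀ s : ℕ, pr (-1) (ζ * q) 5 s = pr (-ζ ^ s) q 5 s := by
    intro s; unfold pr; congr 1; ext k
    rw [mul_pow, pow_add ζ, pow_mul ζ, h5]; ring
  simp only [Fin.prod_univ_five] at h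
  norm_num at h
  unfold eu
  rw [h, key, key, key, key, key, h5]
  ring

lemma eu_norm {ζ : ℂ} (hζ : 1 + ζ + ζ ^ 2 + ζ ^ 3 + ζ ^ 4 = 0) {q : ℂ} (hq : ‖q‖ < 1) :
    eu q * eu (ζ * q) * eu (ζ ^ 2 * q) * eu (ζ ^ 3 * q) * eu (ζ ^ 4 * q)
      = eu (q ^ 5) ^ 6 / eu (q ^ 25) := by
  have h5 : ζ ^ 5 = 1 := by linear_combination (ζ - 1) * hζ
  have h6 : ζ ^ 6 = ζ := by linear_combination ζ * h5
  have h8 : ζ ^ 8 = ζ ^ 3 := by linear_combination ζ ^ 3 * h5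
  have h9 : ζ ^ 9 = ζ ^ 4 := by linear_combination ζ ^ 4 * h5
  have h12 : ζ ^ 12 = ζ ^ 2 := by linear_combination (ζ ^ 7 + ζ ^ 2) * h5
  have h16 : ζ ^ 16 = ζ := by linear_combination (ζ ^ 11 + ζ ^ 6 + ζ) * h5
  have n : ∀ n : ℕ, (ζ ^ n) ^ 5 = 1 := by intro n; rw [← pow_mul, mul_comm, pow_mul, h5, one_pow]
  have e0 := eu_rot (one_pow 5 : (1 : ℂ) ^ 5 = 1) hq
  have e1 := eu_rot h5 hq
  have e2 := eu_rot (n 2) hq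
  have e3 := eu_rot (n 3) hq
  have e4 := eu_rot (n 4) hq
  simp only [← pow_mul] at e2 e3 e4
  norm_num [h6, h8, h9, h12, h16] at e0 e1 e2 e3 e4
  have p1 := pr_five hζ hq (show 0 < 5 by norm_num) 1
  have p2 := pr_five (η := ζ ^ 2) (by ring_nf; linear_combination hζ + ζ * h5 + ζ ^ 3 * h5) hq (show 0 < 5 by norm_num) 2
  have p3 := pr_five (η := ζ ^ 3) (by ring_nf; linear_combination hζ + (ζ + ζ ^ 4 + ζ ^ 7 + ζ ^ 2) * h5) hq (show 0 < 5 by norm_num) 3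
  have p4 := pr_five (η := ζ ^ 4) (by ring_nf; linear_combination hζ + (ζ ^ 11 + ζ ^ 6 + ζ + ζ ^ 7 + ζ ^ 2 + ζ ^ 3) * h5) hq (show 0 < 5 by norm_num) 4
  simp only [← pow_mul] at p2 p3 p4
  norm_num [h6, h8, h9, h12, h16] at p1 p2 p3 p4
  have f5 := pr_split (-1) hq (show 0 < 5 by norm_num) 5 5
  simp only [Fin.prod_univ_five] at f5
  norm_num at f5
  have f25 : eu (q ^ 25) = pr (-1) q 25 25 := eu_pow q 25
  rw [eq_div_iff (eu_ne_zero (pow_lt hq (by norm_num))), f25, e0, e1, e2, e3, e4, eu_pow]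
  rw [← p1, ← p2, ← p3, ← p4] at f5
  linear_combination -(pr (-1) q 5 5) ^ 5 * f5

/-- finite product `(Q; Q)_m` -/
noncomputable def qfin (Q : ℂ) (m : ℕ) : ℂ := ∏ k ∈ Finset.range m, (1 + (-1) * Q ^ (1 * k + 1))

/-- `1 / (Q; Q)_m`, extended by `0` to negative `m` -/
noncomputable def qinv (Q : ℂ) (m : ℤ) : ℂ := if m < 0 then 0 else (qfin Q m.toNat)⁻¹

lemma one_sub_pow_ne {Q : ℂ} (hQ : ‖Q‖ < 1) (k : ℕ) : 1 + (-1) * Q ^ (1 * k + 1) ≠ 0 := by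
  intro h
  have h1 : Q ^ (1 * k + 1) = 1 := by linear_combination -h
  have h2 := pow_lt hQ (n := 1 * k + 1) (by omega)
  rw [h1] at h2; simp at h2

lemma qfin_ne {Q : ℂ} (hQ : ‖Q‖ < 1) (m : ℕ) : qfin Q m ≠ 0 :=
  Finset.prod_ne_zero_iff.2 fun k _ => one_sub_pow_ne hQ k

lemma qinv_rec {Q : ℂ} (hQ : ‖Q‖ < 1) (m : ℤ) :
    qinv Q (m - 1) = (1 - Q ^ m) * qinv Q m := by
  unfold qinv
  rcases lt_trichotomy m 0 with h | h | h
  · rw [if_pos (by omega), if_pos h]; simp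
  · subst h; simp
  · obtain ⟨n, rfl⟩ : ∃ n : ℕ, m = n + 1 := ⟨(m - 1).toNat, by omega⟩
    rw [if_neg (by omega), if_neg (by omega)]
    have e1 : ((n : ℤ) + 1 - 1).toNat = n := by omega
    have e2 : ((n : ℤ) + 1).toNat = n + 1 := by omega
    rw [e1, e2]
    have h0 := qfin_ne hQ n
    have h1 := one_sub_pow_ne hQ n
    have h2 : qfin Q (n + 1) = qfin Q n * (1 + (-1) * Q ^ (1 * n + 1)) := by
      unfold qfin; rw [Finset.prod_range_succ]
    have h3 : Q ^ ((n : ℤ) + 1) = Q ^ (1 * n + 1) := by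
      rw [one_mul]; norm_cast
    rw [h2, h3]
    generalize qfin Q n = A at *
    generalize Q ^ (1 * n + 1) = B at *
    have h4 : 1 - B ≠ 0 := by intro h; apply h1; linear_combination h
    have h5 : 1 + -1 * B = 1 - B := by ring
    rw [h5]; field_simp

/-- general term of the finite triple product -/
noncomputable def jt (t z : ℂ) (N : ℕ) (j : ℤ) : ℂ :=
  qfin (t ^ 2) (2 * N) * qinv (t ^ 2) (N - j) * qinv (t ^ 2) (N + j) * (t ^ (j ^ 2) * z ^ j)

lemma jt_rec {t z : ℂ} (ht : ‖t‖ < 1) (ht0 : t ≠ 0) (hz : z ≠ 0) (N : ℕ) (j : ℤ) :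
    jt t z (N + 1) j = (1 + (t ^ (2 * N + 1)) ^ 2) * jt t z N j
      + t ^ (2 * N + 1) * z * jt t z N (j - 1) + t ^ (2 * N + 1) * z⁻¹ * jt t z N (j + 1) := by
  unfold jt
  have hQ : ‖t ^ 2‖ < 1 := pow_lt ht two_ne_zero
  have r1 := qinv_rec hQ ((N : ℤ) + 1 - j)
  have r2 := qinv_rec hQ ((N : ℤ) + 1 + j)
  have r3 := qinv_rec hQ ((N : ℤ) - j)
  have r4 := qinv_rec hQ ((N : ℤ) + j)
  rw [show (N : ℤ) + 1 - j - 1 = N - j by ring] at r1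
  rw [show (N : ℤ) + 1 + j - 1 = N + j by ring] at r2
  rw [r1] at r3
  rw [r2] at r4
  rw [show ((N + 1 : ℕ) : ℤ) - j = N + 1 - j by push_cast; ring,
    show ((N + 1 : ℕ) : ℤ) + j = N + 1 + j by push_cast; ring,
    show (N : ℤ) - (j - 1) = N + 1 - j by ring,
    show (N : ℤ) + (j + 1) = N + 1 + j by ring,
    show (N : ℤ) - (j + 1) = N - j - 1 by ring,
    show (N : ℤ) + (j - 1) = N + j - 1 by ring, r3, r4, r1, r2]
  have f : qfin (t ^ 2) (2 * (N + 1)) = qfin (t ^ 2) (2 * N) *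
      (1 - t ^ (4 * N + 2)) * (1 - t ^ (4 * N + 4)) := by
    unfold qfin
    rw [show 2 * (N + 1) = 2 * N + 1 + 1 by ring, Finset.prod_range_succ, Finset.prod_range_succ,
      ← pow_mul, ← pow_mul]
    ring_nf
  rw [f]
  generalize qfin (t ^ 2) (2 * N) = A
  generalize qinv (t ^ 2) (N + 1 - j) = B
  generalize qinv (t ^ 2) (N + 1 + j) = C
  have z1 : z ^ (j - 1) = z ^ j * z⁻¹ := zpow_sub_one₀ hz j
  have z2 : z ^ (j + 1) = z ^ j * z := zpow_add_one₀ hz j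
  rw [z1, z2]
  obtain ⟨x, hx⟩ : ∃ x, x = t ^ (j : ℤ) := ⟨_, rfl⟩
  obtain ⟨y, hy⟩ : ∃ y, y = t ^ N := ⟨_, rfl⟩
  have hx0 : x ≠ 0 := by rw [hx]; exact zpow_ne_zero _ ht0
  have hy0 : y ≠ 0 := by rw [hy]; exact pow_ne_zero _ ht0
  have hxi : t ^ (-j : ℤ) = x⁻¹ := by rw [hx, zpow_neg]
  have hyz : t ^ (N : ℤ) = y := by rw [hy, zpow_natCast]
  have z3 : t ^ ((j - 1) ^ 2) = t ^ (j ^ 2) * t * (x⁻¹) ^ 2 := by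
    rw [show (j - 1) ^ 2 = j ^ 2 + 1 + -j + -j by ring, zpow_add₀ ht0, zpow_add₀ ht0,
      zpow_add₀ ht0, hxi, zpow_one]; ring
  have z4 : t ^ ((j + 1) ^ 2) = t ^ (j ^ 2) * t * x ^ 2 := by
    rw [show (j + 1) ^ 2 = j ^ 2 + 1 + j + j by ring, zpow_add₀ ht0, zpow_add₀ ht0,
      zpow_add₀ ht0, ← hx, zpow_one]; ring
  have sq : ∀ m : ℤ, (t ^ 2) ^ m = (t ^ m) ^ 2 := fun m => by
    rw [← zpow_natCast, ← zpow_natCast, ← zpow_mul, ← zpow_mul, mul_comm]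
  have z5 : (t ^ 2) ^ ((N : ℤ) + 1 - j) = (y * t * x⁻¹) ^ 2 := by
    rw [sq, sub_eq_add_neg, zpow_add₀ ht0, zpow_add₀ ht0, hxi, hyz, zpow_one]
  have z6 : (t ^ 2) ^ ((N : ℤ) + 1 + j) = (y * t * x) ^ 2 := by
    rw [sq, zpow_add₀ ht0, zpow_add₀ ht0, ← hx, hyz, zpow_one]
  have z7 : (t ^ 2) ^ ((N : ℤ) - j) = (y * x⁻¹) ^ 2 := by
    rw [sq, sub_eq_add_neg, zpow_add₀ ht0, hxi, hyz]
  have z8 : (t ^ 2) ^ ((N : ℤ) + j) = (y * x) ^ 2 := by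
    rw [sq, zpow_add₀ ht0, ← hx, hyz]
  rw [z3, z4, z5, z6, z7, z8]
  have w1 : t ^ (2 * N + 1) = y ^ 2 * t := by rw [hy]; ring
  have w2 : t ^ (4 * N + 2) = y ^ 4 * t ^ 2 := by rw [hy]; ring
  have w3 : t ^ (4 * N + 4) = y ^ 4 * t ^ 4 := by rw [hy]; ring
  rw [w1, w2, w3]
  generalize t ^ (j ^ 2) = K
  generalize z ^ j = L
  field_simp
  ring

lemma jt_support (t z : ℂ) (N : ℕ) : (Function.support (jt t z N)).Finite := by
  refine (Set.finite_Icc (-(N : ℤ)) N).subset fun j hj => ?_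
  by_contra h
  apply hj
  unfold jt qinv
  rw [Set.mem_Icc, not_and_or] at h
  rcases h with h | h
  · rw [if_pos (show (N : ℤ) + j < 0 by omega)]; simp
  · rw [if_pos (show (N : ℤ) - j < 0 by omega)]; simp

lemma jt_summable (t z : ℂ) (N : ℕ) : Summable (jt t z N) :=
  summable_of_hasFiniteSupport (jt_support t z N)

lemma tsum_shift (f : ℤ → ℂ) (c : ℤ) : ∑' j, f (j + c) = ∑' j, f j :=
  (Equiv.addRight c).tsum_eq f

lemma jt_finite {t z : ℂ} (ht : ‖t‖ < 1) (ht0 : t ≠ 0) (hz : z ≠ 0) (N : ℕ) :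
    ∑' j, jt t z N j = (∏ k ∈ Finset.range N, (1 + z * t ^ (2 * k + 1))) *
      ∏ k ∈ Finset.range N, (1 + z⁻¹ * t ^ (2 * k + 1)) := by
  induction N with
  | zero =>
    rw [tsum_eq_single 0]
    · simp [jt, qfin, qinv]
    · intro j hj
      unfold jt qinv
      rcases lt_or_gt_of_ne hj with h | h
      · rw [if_pos (show ((0 : ℕ) : ℤ) + j < 0 by simpa using h)]; simp
      · rw [if_pos (show ((0 : ℕ) : ℤ) - j < 0 by simpa using h)]; simp
  | succ N ih =>
    have s := jt_summable t z N
    have s1 : Summable (fun j => jt t z N (j - 1)) := 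
      s.comp_injective (i := fun j : ℤ => j - 1) (fun a b h => by simpa using h)
    have s2 : Summable (fun j => jt t z N (j + 1)) := 
      s.comp_injective (i := fun j : ℤ => j + 1) (fun a b h => by simpa using h)
    simp_rw [jt_rec ht ht0 hz N]
    rw [((s.mul_left _).add (s1.mul_left _)).tsum_add (s2.mul_left _),
      (s.mul_left _).tsum_add (s1.mul_left _), tsum_mul_left, tsum_mul_left, tsum_mul_left,
      tsum_shift (jt t z N) 1]
    simp_rw [sub_eq_add_neg]
    rw [tsum_shift (jt t z N) (-1), ih, Finset.prod_range_succ, Finset.prod_range_succ]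
    field_simp
    ring

lemma summable_theta_nat {r s : ℝ} (hr0 : 0 < r) (hr : r < 1) (hs : 0 < s) :
    Summable (fun n : ℕ => r ^ (n ^ 2) * s ^ n) := by
  refine summable_of_ratio_test_tendsto_lt_one (l := 0) one_pos
    (Filter.Eventually.of_forall fun n => by positivity) ?_
  have h : (fun n : ℕ => ‖r ^ ((n + 1) ^ 2) * s ^ (n + 1)‖ / ‖r ^ (n ^ 2) * s ^ n‖)
      = fun n : ℕ => r * s * (r ^ 2) ^ n := by
    ext n
    rw [Real.norm_of_nonneg (by positivity), Real.norm_of_nonneg (by positivity),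
      div_eq_iff (by positivity)]
    ring
  rw [h]
  have := (tendsto_pow_atTop_nhds_zero_of_lt_one (sq_nonneg r)
    (pow_lt_one₀ hr0.le hr two_ne_zero)).const_mul (r * s)
  simpa using this

lemma summable_theta_real {r s : ℝ} (hr0 : 0 < r) (hr : r < 1) (hs : 0 < s) :
    Summable (fun n : ℤ => r ^ (n ^ 2) * s ^ n) := by
  refine Summable.of_nat_of_neg ?_ ?_
  · refine (summable_theta_nat hr0 hr hs).congr fun n => ?_
    norm_cast
  · refine (summable_theta_nat hr0 hr (inv_pos.2 hs)).congr fun n => ?_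
    rw [neg_sq, zpow_neg, inv_pow]; norm_cast

lemma norm_theta (t z : ℂ) (n : ℤ) : ‖t ^ (n ^ 2) * z ^ n‖ = ‖t‖ ^ (n ^ 2) * ‖z‖ ^ n := by
  rw [norm_mul, norm_zpow, norm_zpow]

lemma summable_theta {t z : ℂ} (ht : ‖t‖ < 1) (ht0 : t ≠ 0) (hz : z ≠ 0) :
    Summable (fun n : ℤ => ‖t ^ (n ^ 2) * z ^ n‖) := by
  simp_rw [norm_theta]
  exact summable_theta_real (norm_pos_iff.2 ht0) ht (norm_pos_iff.2 hz)

lemma qfin_tendsto {Q : ℂ} (hQ : ‖Q‖ < 1) :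
    Filter.Tendsto (qfin Q) Filter.atTop (nhds (eu Q)) :=
  (multipliable_pr (-1) hQ one_pos 1).hasProd.tendsto_prod_nat

lemma qinv_bounded {Q : ℂ} (hQ : ‖Q‖ < 1) : ∃ K : ℝ, ∀ m, ‖qinv Q m‖ ≤ K := by
  have h := (qfin_tendsto hQ).inv₀ (eu_ne_zero hQ)
  obtain ⟨K, hK⟩ := (Metric.isBounded_range_of_tendsto _ h).exists_norm_le
  refine ⟨K, fun m => ?_⟩
  have h0 := hK _ ⟨m.toNat, rfl⟩
  unfold qinv
  split_ifs
  · rw [norm_zero]; exact (norm_nonneg _).trans h0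
  · exact h0

lemma qinv_tendsto {Q : ℂ} (hQ : ‖Q‖ < 1) (f : ℕ → ℤ) (hf : Filter.Tendsto f Filter.atTop Filter.atTop) :
    Filter.Tendsto (fun N => qinv Q (f N)) Filter.atTop (nhds (eu Q)⁻¹) := by
  have h := (qfin_tendsto hQ).inv₀ (eu_ne_zero hQ)
  have h1 : Filter.Tendsto (fun N => (f N).toNat) Filter.atTop Filter.atTop := by
    rw [Filter.tendsto_atTop]
    intro b
    filter_upwards [hf.eventually_ge_atTop (b : ℤ)] with N hN
    omega
  refine (h.comp h1).congr' ?_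
  filter_upwards [hf.eventually_ge_atTop 0] with N hN
  simp [qinv, not_lt.2 hN]

/-- The Jacobi triple product identity. -/
lemma jacobi_triple {t z : ℂ} (ht : ‖t‖ < 1) (ht0 : t ≠ 0) (hz : z ≠ 0) :
    ∑' n : ℤ, t ^ (n ^ 2) * z ^ n = pr (-1) t 2 2 * pr z t 2 1 * pr z⁻¹ t 2 1 := by
  have hQ : ‖t ^ 2‖ < 1 := pow_lt ht two_ne_zero
  obtain ⟨K, hK⟩ := qinv_bounded hQ
  obtain ⟨L, hL⟩ := (Metric.isBounded_range_of_tendsto _ (qfin_tendsto hQ)).exists_norm_le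
  have hE := eu_ne_zero hQ
  have T1 : Filter.Tendsto (fun N => ∑' j, jt t z N j) Filter.atTop
      (nhds (∑' j : ℤ, (eu (t ^ 2))⁻¹ * (t ^ (j ^ 2) * z ^ j))) := by
    refine tendsto_tsum_of_dominated_convergence
      (bound := fun j : ℤ => L * K * K * ‖t ^ (j ^ 2) * z ^ j‖)
      ((summable_theta ht ht0 hz).mul_left _) ?_ ?_
    · intro j
      have a1 : Filter.Tendsto (fun N : ℕ => qfin (t ^ 2) (2 * N)) Filter.atTop (nhds (eu (t ^ 2))) :=
        (qfin_tendsto hQ).comp (Filter.tendsto_id.const_mul_atTop' two_pos)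
      have c1 : Filter.Tendsto (fun N : ℕ => (N : ℤ)) Filter.atTop Filter.atTop :=
        tendsto_natCast_atTop_atTop
      have a2 := qinv_tendsto hQ (fun N : ℕ => (N : ℤ) - j)
        (by simpa [sub_eq_add_neg] using Filter.tendsto_atTop_add_const_right _ (-j) c1)
      have a3 := qinv_tendsto hQ (fun N : ℕ => (N : ℤ) + j)
        (Filter.tendsto_atTop_add_const_right _ j c1)
      have := ((a1.mul a2).mul a3).mul_const (t ^ (j ^ 2) * z ^ j)
      rwa [mul_inv_cancel₀ hE, one_mul] at this
    · refine Filter.Eventually.of_forall fun N j => ?_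
      unfold jt
      rw [norm_mul, norm_mul, norm_mul]
      have l := hL _ ⟨2 * N, rfl⟩
      have l0 : 0 ≤ L := (norm_nonneg _).trans l
      have k0 : 0 ≤ K := (norm_nonneg _).trans (hK 0)
      gcongr
      · exact hK _
      · exact hK _
  have T2 : Filter.Tendsto (fun N => ∑' j, jt t z N j) Filter.atTop
      (nhds (pr z t 2 1 * pr z⁻¹ t 2 1)) := by
    simp_rw [jt_finite ht ht0 hz]
    exact (multipliable_pr z ht two_pos 1).hasProd.tendsto_prod_nat.mul
      (multipliable_pr z⁻¹ ht two_pos 1).hasProd.tendsto_prod_nat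
  have := tendsto_nhds_unique T1 T2
  rw [tsum_mul_left, inv_mul_eq_iff_eq_mul₀ hE, eu_pow] at this
  rw [this]; ring

/-- weight depending on parity only -/
noncomputable def par (α : ℂ) (x : ℤ) : ℂ := if Even x then α else 1

lemma par_congr (α : ℂ) {x y : ℤ} (h : x % 2 = y % 2) : par α x = par α y := by
  unfold par
  simp only [Int.even_iff, h]

/-- general term of the weighted theta series -/
noncomputable def tg (α P : ℂ) (x : ℤ) : ℂ := par α x * P ^ (x ^ 2)

lemma tg_summable (α : ℂ) {P : ℂ} (hP : ‖P‖ < 1) (hP0 : P ≠ 0) :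
    Summable (fun x => ‖tg α P x‖) := by
  have h := (summable_theta hP hP0 one_ne_zero).mul_left (‖α‖ + 1)
  refine Summable.of_nonneg_of_le (fun _ => norm_nonneg _) (fun x => ?_) h
  unfold tg par
  rw [norm_mul, one_zpow, mul_one]
  gcongr
  split_ifs
  · linarith
  · rw [norm_one]; linarith [norm_nonneg α]

lemma tg_neg (α P : ℂ) (x : ℤ) : tg α P (-x) = tg α P x := by
  unfold tg
  rw [neg_sq, par_congr α (show (-x) % 2 = x % 2 by omega)]

/-- the full theta series -/
noncomputable def th (α P : ℂ) : ℂ := ∑' x : ℤ, tg α P x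

/-- the theta series over a residue class modulo five -/
noncomputable def thr (α P : ℂ) (r : ℤ) : ℂ := ∑' m : ℤ, tg α P (5 * m + r)

lemma thr_shift (α P : ℂ) (r s : ℤ) : thr α P (r + 5 * s) = thr α P r := by
  unfold thr
  rw [← tsum_shift (fun m => tg α P (5 * m + r)) s]
  congr 1; ext m; congr 1; ring

lemma thr_neg (α P : ℂ) (r : ℤ) : thr α P (-r) = thr α P r := by
  unfold thr
  rw [← (Equiv.neg ℤ).tsum_eq]
  congr 1; ext m
  rw [← tg_neg]; congr 1; simp only [Equiv.neg_apply]; ring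

lemma thr_summable (α : ℂ) {P : ℂ} (hP : ‖P‖ < 1) (hP0 : P ≠ 0) (r : ℤ) :
    Summable (fun m : ℤ => ‖tg α P (5 * m + r)‖) :=
  (tg_summable α hP hP0).comp_injective (i := fun m : ℤ => 5 * m + r)
    (fun a b h => by simpa using h)

lemma exists_int_equiv : ∃ e : Fin 5 × ℤ ≃ ℤ, ∀ p, e p = 5 * p.2 + (p.1 : ℕ) := by
  have hb : Function.Bijective (fun p : Fin 5 × ℤ => 5 * p.2 + ((p.1 : ℕ) : ℤ)) := by
    constructor
    · rintro ⟨⟨r, hr⟩, m⟩ ⟨⟨s, hs⟩, n⟩ h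
      simp only at h
      have h1 : r = s := by omega
      have h2 : m = n := by omega
      subst h1 h2; rfl
    · intro x
      refine ⟨⟨⟨(x % 5).toNat, by omega⟩, x / 5⟩, ?_⟩
      simp only
      omega
  exact ⟨Equiv.ofBijective _ hb, fun p => rfl⟩

lemma exists_lattice_equiv : ∃ e : Fin 5 × (ℤ × ℤ) ≃ ℤ × ℤ,
    ∀ p, e p = (2 * p.2.1 + p.2.2 + (p.1 : ℕ), 2 * p.2.2 - p.2.1 + (p.1 : ℕ)) := by
  have hb : Function.Bijective (fun p : Fin 5 × (ℤ × ℤ) =>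
      (2 * p.2.1 + p.2.2 + ((p.1 : ℕ) : ℤ), 2 * p.2.2 - p.2.1 + ((p.1 : ℕ) : ℤ))) := by
    constructor
    · rintro ⟨⟨r, hr⟩, m, k⟩ ⟨⟨s, hs⟩, n, l⟩ h
      simp only [Prod.mk.injEq] at h
      obtain ⟨h', h''⟩ := h
      have h1 : r = s := by omega
      have h2 : m = n := by omega
      have h3 : k = l := by omega
      subst h1 h2 h3; rfl
    · rintro ⟨M, N⟩
      refine ⟨⟨⟨((2 * M - N) % 5).toNat, by omega⟩, (2 * M - N) / 5,
        M - 2 * ((2 * M - N) / 5) - (2 * M - N) % 5⟩, ?_⟩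
      simp only [Prod.mk.injEq]
      constructor <;> omega
  exact ⟨Equiv.ofBijective _ hb, fun p => rfl⟩

lemma th_split (α : ℂ) {P : ℂ} (hP : ‖P‖ < 1) (hP0 : P ≠ 0) :
    th α P = thr α P 0 + 2 * thr α P 1 + 2 * thr α P 2 := by
  obtain ⟨e, he⟩ := exists_int_equiv
  have hs : Summable (fun p : Fin 5 × ℤ => tg α P (e p)) :=
    (tg_summable α hP hP0).of_norm.comp_injective e.injective
  have h1 : ∑' p : Fin 5 × ℤ, tg α P (e p) = th α P := e.tsum_eq (tg α P)
  rw [← h1, hs.tsum_prod, tsum_fintype]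
  simp only [he]
  have h3 : thr α P 3 = thr α P 2 := by
    have := thr_shift α P (-2) 1
    rw [thr_neg] at this; simpa using this
  have h4 : thr α P 4 = thr α P 1 := by
    have := thr_shift α P (-1) 1
    rw [thr_neg] at this; simpa using this
  have h5 : ∀ r : Fin 5, ∑' m : ℤ, tg α P (5 * m + ((r : ℕ) : ℤ)) = thr α P (r : ℕ) := fun r => rfl
  simp only [h5, Fin.sum_univ_five]
  norm_num [h3, h4]
  ring

lemma th_sq (α : ℂ) {P : ℂ} (hP : ‖P‖ < 1) (hP0 : P ≠ 0) :
    th α (P ^ 5) ^ 2 = thr α P 0 ^ 2 + 4 * thr α P 1 * thr α P 2 := by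
  obtain ⟨e, he⟩ := exists_lattice_equiv
  have hP5 := pow_lt hP (n := 5) (by norm_num)
  have s5 := tg_summable α hP5 (pow_ne_zero 5 hP0)
  have hprod := tsum_mul_tsum_of_summable_norm s5 s5
  have s2 : Summable (fun z : ℤ × ℤ => tg α (P ^ 5) z.1 * tg α (P ^ 5) z.2) :=
    summable_mul_of_summable_norm s5 s5
  have hs : Summable (fun p : Fin 5 × (ℤ × ℤ) => tg α (P ^ 5) (e p).1 * tg α (P ^ 5) (e p).2) :=
    s2.comp_injective e.injective
  have h1 : ∑' p : Fin 5 × (ℤ × ℤ), tg α (P ^ 5) (e p).1 * tg α (P ^ 5) (e p).2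
      = ∑' z : ℤ × ℤ, tg α (P ^ 5) z.1 * tg α (P ^ 5) z.2 :=
    e.tsum_eq (fun z : ℤ × ℤ => tg α (P ^ 5) z.1 * tg α (P ^ 5) z.2)
  have key : ∀ p : Fin 5 × (ℤ × ℤ), tg α (P ^ 5) (e p).1 * tg α (P ^ 5) (e p).2
      = tg α P (5 * p.2.1 + (p.1 : ℕ)) * tg α P (5 * p.2.2 + 3 * (p.1 : ℕ)) := by
    rintro ⟨r, m, n⟩
    rw [he]
    simp only [tg]
    generalize ((r : ℕ) : ℤ) = s
    rw [par_congr α (show (2 * m + n + s) % 2 = (5 * n + 3 * s) % 2 by omega),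
      par_congr α (show (2 * n - m + s) % 2 = (5 * m + s) % 2 by omega)]
    have e5 : ∀ k : ℤ, (P ^ 5) ^ k = P ^ (5 * k) := fun k => by
      rw [← zpow_natCast, ← zpow_mul]; norm_num
    have : (P ^ 5) ^ ((2 * m + n + s) ^ 2) * (P ^ 5) ^ ((2 * n - m + s) ^ 2)
        = P ^ ((5 * m + s) ^ 2) * P ^ ((5 * n + 3 * s) ^ 2) := by
      rw [e5, e5, ← zpow_add₀ hP0, ← zpow_add₀ hP0]; congr 1; ring
    linear_combination par α (5 * n + 3 * s) * par α (5 * m + s) * this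
  unfold th
  rw [sq, hprod, ← h1, hs.tsum_prod, tsum_fintype]
  simp only [key]
  have h5 : ∀ r : Fin 5, ∑' z : ℤ × ℤ, tg α P (5 * z.1 + ((r : ℕ) : ℤ)) *
      tg α P (5 * z.2 + 3 * ((r : ℕ) : ℤ)) = thr α P (r : ℕ) * thr α P (3 * (r : ℕ)) := fun r => by
    unfold thr
    rw [tsum_mul_tsum_of_summable_norm (thr_summable α hP hP0 _) (thr_summable α hP hP0 _)]
  have h3 : thr α P 3 = thr α P 2 := by
    have := thr_shift α P (-2) 1
    rw [thr_neg] at this; simpa using this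
  have h4 : thr α P 4 = thr α P 1 := by
    have := thr_shift α P (-1) 1
    rw [thr_neg] at this; simpa using this
  have h6 : thr α P 6 = thr α P 1 := by simpa using thr_shift α P 1 1
  have h9 : thr α P 9 = thr α P 1 := by
    have := thr_shift α P 4 1
    rw [h4] at this; simpa using this
  have h12 : thr α P 12 = thr α P 2 := by simpa using thr_shift α P 2 2
  simp only [h5, Fin.sum_univ_five]
  norm_num [h3, h4, h6, h9, h12]
  ring

lemma thr_zero (α P : ℂ) : thr α P 0 = th α (P ^ 25) := by
  unfold thr th
  congr 1; ext m
  unfold tg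
  rw [par_congr α (show (5 * m + 0) % 2 = m % 2 by omega)]
  congr 1
  rw [← zpow_natCast, ← zpow_mul]; congr 1; push_cast; ring

lemma thr_rot (α P : ℂ) {ζ : ℂ} (h5 : ζ ^ 5 = 1) :
    thr α (ζ * P) 0 = thr α P 0 ∧ thr α (ζ * P) 1 = ζ * thr α P 1 ∧
    thr α (ζ * P) 2 = ζ ^ 4 * thr α P 2 := by
  have hz0 : ζ ≠ 0 := by rintro rfl; norm_num at h5
  have key : ∀ r m : ℤ, tg α (ζ * P) (5 * m + r) = ζ ^ (r ^ 2) * tg α P (5 * m + r) := by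
    intro r m
    unfold tg
    rw [mul_zpow, show (5 * m + r) ^ 2 = r ^ 2 + (5 : ℕ) * (5 * m ^ 2 + 2 * m * r) by push_cast; ring,
      zpow_add₀ hz0, zpow_mul ζ, zpow_natCast, h5, one_zpow]
    ring
  have key2 : ∀ r : ℤ, thr α (ζ * P) r = ζ ^ (r ^ 2) * thr α P r := by
    intro r
    unfold thr
    rw [← tsum_mul_left]; congr 1; ext m; exact key r m
  refine ⟨by rw [key2]; simp, by rw [key2]; simp, ?_⟩
  rw [key2]; norm_num

lemma theta_eval {P : ℂ} (hP : ‖P‖ < 1) (hP0 : P ≠ 0) {A B : ℕ} (hA : 0 < A) (hB : B ≤ A) (C : ℕ) :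
    ∑' n : ℤ, P ^ (A * n ^ 2 + B * n + C) =
      P ^ C * (pr (-1) P (2 * A) (2 * A) * pr 1 P (2 * A) (A + B) * pr 1 P (2 * A) (A - B)) := by
  have h := jacobi_triple (t := P ^ A) (z := P ^ B) (pow_lt hP hA.ne') (pow_ne_zero _ hP0)
    (pow_ne_zero _ hP0)
  have e1 : pr (P ^ B) (P ^ A) 2 1 = pr 1 P (2 * A) (A + B) := by
    unfold pr; congr 1; ext k; rw [← pow_mul, ← pow_add, one_mul]; congr 2; ring
  have e2 : pr (P ^ B)⁻¹ (P ^ A) 2 1 = pr 1 P (2 * A) (A - B) := by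
    unfold pr; congr 1; ext k
    rw [← pow_mul, one_mul, inv_mul_eq_iff_eq_mul₀ (pow_ne_zero _ hP0) |>.2]
    rw [← pow_add]; congr 1
    zify [hB]; ring
  rw [e1, e2, pr_pow, mul_comm A 2] at h
  rw [← h, ← tsum_mul_left]
  congr 1; ext n
  rw [zpow_add₀ hP0, zpow_add₀ hP0, zpow_natCast, zpow_mul, zpow_mul, zpow_natCast, zpow_natCast]
  ring

/-- `ψ(q)` -/
noncomputable def psi (q : ℂ) : ℂ := eu (q ^ 2) ^ 2 / eu q

/-- `φ(q)` -/
noncomputable def phi (q : ℂ) : ℂ := eu (q ^ 2) ^ 5 / (eu q ^ 2 * eu (q ^ 4) ^ 2)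

lemma psi_ne_zero {q : ℂ} (hq : ‖q‖ < 1) : psi q ≠ 0 :=
  div_ne_zero (pow_ne_zero _ (eu_ne_zero (pow_lt hq two_ne_zero))) (eu_ne_zero hq)

lemma th_one {P : ℂ} (hP : ‖P‖ < 1) (hP0 : P ≠ 0) : th 1 P = phi P := by
  have h := theta_eval hP hP0 (A := 1) (B := 0) one_pos (by norm_num) 0
  have e : th 1 P = ∑' n : ℤ, P ^ (((1 : ℕ) : ℤ) * n ^ 2 + ((0 : ℕ) : ℤ) * n + ((0 : ℕ) : ℤ)) := by
    unfold th tg par; congr 1; ext n; simp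
  rw [e, h]
  norm_num
  rw [pr_plus_odd hP, ← eu_pow]
  unfold phi
  have n1 := eu_ne_zero hP
  have n4 := eu_ne_zero (pow_lt hP four_ne_zero)
  field_simp

lemma tsum_even {f : ℤ → ℂ} (hf : ∀ n, f (2 * n + 1) = 0) : ∑' n, f n = ∑' n, f (2 * n) := by
  symm
  refine Function.Injective.tsum_eq (g := fun n : ℤ => 2 * n) (fun a b h => by simpa using h) ?_
  intro x hx
  rcases Int.even_or_odd' x with ⟨k, hk | hk⟩
  · exact ⟨k, hk.symm⟩
  · exact absurd (hk ▸ hf k) hx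

lemma tsum_odd {f : ℤ → ℂ} (hf : ∀ n, f (2 * n) = 0) : ∑' n, f n = ∑' n, f (2 * n + 1) := by
  symm
  refine Function.Injective.tsum_eq (g := fun n : ℤ => 2 * n + 1) (fun a b h => by simpa using h) ?_
  intro x hx
  rcases Int.even_or_odd' x with ⟨k, hk | hk⟩
  · exact absurd (hk ▸ hf k) hx
  · exact ⟨k, hk.symm⟩

lemma tg_zero_even (P : ℂ) {x : ℤ} (h : x % 2 = 0) : tg 0 P x = 0 := by
  simp [tg, par, Int.even_iff, h]

lemma tg_zero_odd (P : ℂ) {x : ℤ} (h : x % 2 = 1) : tg 0 P x = P ^ (x ^ 2) := by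
  simp [tg, par, Int.even_iff, h]

lemma pr_first {q : ℂ} (hq : ‖q‖ < 1) : pr 1 q 1 0 = 2 * pr 1 q 1 1 := by
  have h := (multipliable_pr 1 hq one_pos 1)
  unfold pr
  rw [tprod_eq_zero_mul' (by simpa using h)]
  norm_num

lemma th_zero {P : ℂ} (hP : ‖P‖ < 1) (hP0 : P ≠ 0) : th 0 P = 2 * P * psi (P ^ 8) := by
  have h := theta_eval hP hP0 (A := 4) (B := 4) (by norm_num) le_rfl 1
  have e : th 0 P = ∑' n : ℤ, P ^ (((4 : ℕ) : ℤ) * n ^ 2 + ((4 : ℕ) : ℤ) * n + ((1 : ℕ) : ℤ)) := by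
    unfold th
    rw [tsum_odd (fun n => tg_zero_even P (by omega))]
    congr 1; ext n
    rw [tg_zero_odd P (by omega)]; congr 1; push_cast; ring
  have h8 := pow_lt hP (n := 8) (by norm_num)
  rw [e, h]
  norm_num
  have e1 := pr_pow 1 P 8 1 1
  have e2 := pr_pow 1 P 8 1 0
  norm_num at e1 e2
  rw [← e1, ← e2, pr_first h8, pr_plus h8, ← eu_pow]
  unfold psi
  have n1 := eu_ne_zero h8
  field_simp

lemma identK2 {q : ℂ} (hq : ‖q‖ < 1) (hq0 : q ≠ 0) :
    phi q ^ 2 = phi (q ^ 5) ^ 2 + 4 * q * (eu (q ^ 10) ^ 2 * (eu (q ^ 2) ^ 2 / (eu q * eu (q ^ 4)))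
      / (eu (q ^ 10) ^ 2 / (eu (q ^ 5) * eu (q ^ 20)))) := by
  obtain ⟨P, hPq⟩ := IsAlgClosed.exists_pow_nat_eq q (show 0 < 5 by norm_num)
  have hP0 : P ≠ 0 := by rintro rfl; apply hq0; rw [← hPq]; norm_num
  have hP : ‖P‖ < 1 := by
    rw [← hPq, norm_pow] at hq
    exact (pow_lt_one_iff_of_nonneg (norm_nonneg _) (by norm_num)).1 hq
  have h := th_sq 1 hP hP0
  rw [thr_zero, th_one (pow_lt hP (by norm_num)) (pow_ne_zero _ hP0),
    th_one (pow_lt hP (by norm_num)) (pow_ne_zero _ hP0)] at h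
  have t1 := theta_eval hP hP0 (A := 25) (B := 10) (by norm_num) (by norm_num) 1
  have t2 := theta_eval hP hP0 (A := 25) (B := 20) (by norm_num) (by norm_num) 4
  have s1 : thr 1 P 1 = ∑' n : ℤ, P ^ (((25 : ℕ) : ℤ) * n ^ 2 + ((10 : ℕ) : ℤ) * n + ((1 : ℕ) : ℤ)) := by
    unfold thr tg par; congr 1; ext n
    rw [ite_self, one_mul]; congr 1; push_cast; ring
  have s2 : thr 1 P 2 = ∑' n : ℤ, P ^ (((25 : ℕ) : ℤ) * n ^ 2 + ((20 : ℕ) : ℤ) * n + ((4 : ℕ) : ℤ)) := by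
    unfold thr tg par; congr 1; ext n
    rw [ite_self, one_mul]; congr 1; push_cast; ring
  rw [s1, s2, t1, t2] at h
  norm_num at h
  have c0 := pr_pow (-1) P 5 10 10
  have c1 := pr_pow 1 P 5 10 1
  have c3 := pr_pow 1 P 5 10 3
  have c7 := pr_pow 1 P 5 10 7
  have c9 := pr_pow 1 P 5 10 9
  norm_num at c0 c1 c3 c7 c9
  rw [← c0, ← c1, ← c3, ← c7, ← c9, hPq, show P ^ 25 = q ^ 5 by rw [← hPq]; ring, ← eu_pow] at h
  have h5 := pow_lt hq (n := 5) (by norm_num)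
  have sp := pr_split 1 hq two_pos 1 5
  have c5 := pr_pow 1 q 5 2 1
  simp only [Fin.prod_univ_five] at sp
  norm_num at sp c5
  rw [← c5, pr_plus_odd hq, pr_plus_odd h5, ← pow_mul, ← pow_mul] at sp
  norm_num at sp
  rw [h, sp]
  have n5 := eu_ne_zero h5
  have n10 := eu_ne_zero (pow_lt hq (n := 10) (by norm_num))
  have n20 := eu_ne_zero (pow_lt hq (n := 20) (by norm_num))
  generalize pr 1 q 10 1 = x1
  generalize pr 1 q 10 3 = x3
  generalize pr 1 q 10 7 = x7
  generalize pr 1 q 10 9 = x9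
  generalize phi (q ^ 5) = f
  generalize eu (q ^ 5) = y5 at *
  generalize eu (q ^ 10) = y10 at *
  generalize eu (q ^ 20) = y20 at *
  have e : y10 ^ 2 * (x1 * x3 * (y10 ^ 2 / (y5 * y20)) * x7 * x9) / (y10 ^ 2 / (y5 * y20))
      = y10 ^ 2 * (x1 * x3 * x7 * x9) := by
    field_simp
  rw [e, ← hPq]
  ring

lemma identK1 {q : ℂ} (hq : ‖q‖ < 1) (hq0 : q ≠ 0) :
    psi q ^ 2 = q * psi (q ^ 5) ^ 2 + eu (q ^ 5) ^ 2 * (eu (q ^ 2) / eu q)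
      / (eu (q ^ 10) / eu (q ^ 5)) := by
  obtain ⟨P, hPq⟩ := IsAlgClosed.exists_pow_nat_eq q (show 0 < 40 by norm_num)
  have hP0 : P ≠ 0 := by rintro rfl; apply hq0; rw [← hPq]; norm_num
  have hP : ‖P‖ < 1 := by
    rw [← hPq, norm_pow] at hq
    exact (pow_lt_one_iff_of_nonneg (norm_nonneg _) (by norm_num)).1 hq
  have h := th_sq 0 hP hP0
  rw [thr_zero, th_zero (pow_lt hP (by norm_num)) (pow_ne_zero _ hP0),
    th_zero (pow_lt hP (by norm_num)) (pow_ne_zero _ hP0)] at h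
  have t1 := theta_eval hP hP0 (A := 100) (B := 20) (by norm_num) (by norm_num) 1
  have t2 := theta_eval hP hP0 (A := 100) (B := 60) (by norm_num) (by norm_num) 9
  have s1 : thr 0 P 1 = ∑' n : ℤ, P ^ (((100 : ℕ) : ℤ) * n ^ 2 + ((20 : ℕ) : ℤ) * n + ((1 : ℕ) : ℤ)) := by
    unfold thr
    rw [tsum_even (f := fun m => tg 0 P (5 * m + 1)) (fun n => tg_zero_even P (by omega))]
    congr 1; ext n
    rw [tg_zero_odd P (by omega)]; congr 1; push_cast; ring
  have s2 : thr 0 P 2 = ∑' n : ℤ, P ^ (((100 : ℕ) : ℤ) * n ^ 2 + ((60 : ℕ) : ℤ) * n + ((9 : ℕ) : ℤ)) := by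
    rw [← thr_neg]
    unfold thr
    rw [tsum_odd (f := fun m => tg 0 P (5 * m + -2)) (fun n => tg_zero_even P (by omega))]
    congr 1; ext n
    rw [tg_zero_odd P (by omega)]; congr 1; push_cast; ring
  rw [s1, s2, t1, t2] at h
  norm_num at h
  have c0 := pr_pow (-1) P 40 5 5
  have c1 := pr_pow 1 P 40 5 1
  have c2 := pr_pow 1 P 40 5 2
  have c3 := pr_pow 1 P 40 5 3
  have c4 := pr_pow 1 P 40 5 4
  norm_num at c0 c1 c2 c3 c4
  rw [← c0, ← c1, ← c2, ← c3, ← c4, ← pow_mul, ← pow_mul, hPq,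
    show P ^ (25 * 8) = q ^ 5 by rw [← hPq]; ring, ← eu_pow] at h
  have h5 := pow_lt hq (n := 5) (by norm_num)
  have sp := pr_split 1 hq one_pos 1 5
  have c5 := pr_pow 1 q 5 1 1
  simp only [Fin.prod_univ_five] at sp
  norm_num at sp c5
  rw [← c5, pr_plus hq, pr_plus h5, ← pow_mul] at sp
  norm_num at sp
  rw [sp]
  have n5 := eu_ne_zero h5
  have n10 := eu_ne_zero (pow_lt hq (n := 10) (by norm_num))
  have hP10 : 4 * P ^ 10 ≠ 0 := mul_ne_zero (by norm_num) (pow_ne_zero _ hP0)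
  apply mul_left_cancel₀ hP10
  generalize pr 1 q 5 1 = x1 at *
  generalize pr 1 q 5 2 = x2 at *
  generalize pr 1 q 5 3 = x3 at *
  generalize pr 1 q 5 4 = x4 at *
  generalize eu (q ^ 5) = y5 at *
  generalize eu (q ^ 10) = y10 at *
  generalize psi q = y1 at *
  generalize psi (q ^ 5) = y2 at *
  rw [← hPq]
  have e : y5 ^ 2 * (x1 * x2 * x3 * x4 * (y10 / y5)) / (y10 / y5) = y5 ^ 2 * (x1 * x2 * x3 * x4) := by
    field_simp
  rw [e]
  linear_combination h

lemma e4_aux (a b c s p : ℂ) (h1 : s + p = -1) (h2 : s * p = -1) :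
    (a ^ 2 + b ^ 2 + c ^ 2 + s * (a * (b + c)) + p * (b * c)) *
      (a ^ 2 + b ^ 2 + c ^ 2 + p * (a * (b + c)) + s * (b * c)) +
    (a + b + c) * ((2 * a + s * (b + c)) *
      (a ^ 2 + b ^ 2 + c ^ 2 + p * (a * (b + c)) + s * (b * c)) +
      (2 * a + p * (b + c)) * (a ^ 2 + b ^ 2 + c ^ 2 + s * (a * (b + c)) + p * (b * c)))
    = 5 * (a ^ 4 - 3 * a ^ 2 * b * c + b ^ 2 * c ^ 2) := by
  have hp : p = -1 - s := by linear_combination h1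
  subst hp
  have h2' : s ^ 2 = 1 - s := by linear_combination -h2
  have h3 : s ^ 3 = 2 * s - 1 := by linear_combination (s - 1) * h2'
  have h4 : s ^ 4 = 2 - 3 * s := by linear_combination (s ^ 2 - s + 2) * h2'
  ring_nf
  simp only [h2', h3, h4]
  ring

lemma e4_ident (a b c w : ℂ) (hw : 1 + w + w ^ 2 + w ^ 3 + w ^ 4 = 0) {T0 T1 T2 T3 T4 : ℂ}
    (h0 : T0 = a + b + c) (h1 : T1 = a + w * b + w ^ 4 * c)
    (h2 : T2 = a + w ^ 2 * b + w ^ 3 * c) (h3 : T3 = a + w ^ 3 * b + w ^ 2 * c)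
    (h4 : T4 = a + w ^ 4 * b + w * c) :
    T1 * T2 * T3 * T4 + T0 * T2 * T3 * T4 + T0 * T1 * T3 * T4 + T0 * T1 * T2 * T4
      + T0 * T1 * T2 * T3 = 5 * (a ^ 4 - 3 * a ^ 2 * b * c + b ^ 2 * c ^ 2) := by
  have h5 : w ^ 5 = 1 := by linear_combination (w - 1) * hw
  have k14 : T1 * T4 = a ^ 2 + b ^ 2 + c ^ 2 + (w + w ^ 4) * (a * (b + c))
      + (w ^ 2 + w ^ 3) * (b * c) := by
    rw [h1, h4]
    linear_combination (b ^ 2 + c ^ 2 + w ^ 3 * b * c) * h5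
  have k23 : T2 * T3 = a ^ 2 + b ^ 2 + c ^ 2 + (w ^ 2 + w ^ 3) * (a * (b + c))
      + (w + w ^ 4) * (b * c) := by
    rw [h2, h3]
    linear_combination (b ^ 2 + c ^ 2 + w * b * c) * h5
  have e := e4_aux a b c (w + w ^ 4) (w ^ 2 + w ^ 3) (by linear_combination hw)
    (by linear_combination hw + (w + w ^ 2) * h5)
  rw [← k14, ← k23, ← h0] at e
  have m1 : T1 + T4 = 2 * a + (w + w ^ 4) * (b + c) := by rw [h1, h4]; ring
  have m2 : T2 + T3 = 2 * a + (w ^ 2 + w ^ 3) * (b + c) := by rw [h2, h3]; ring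
  rw [← m1, ← m2] at e
  linear_combination e

lemma psi_norm {w : ℂ} (hw : 1 + w + w ^ 2 + w ^ 3 + w ^ 4 = 0) {q : ℂ} (hq : ‖q‖ < 1) :
    psi q * psi (w * q) * psi (w ^ 2 * q) * psi (w ^ 3 * q) * psi (w ^ 4 * q)
      = psi (q ^ 5) ^ 6 / psi (q ^ 25) := by
  have h5 : w ^ 5 = 1 := by linear_combination (w - 1) * hw
  have n1 := eu_norm hw hq
  have hw2 : 1 + w ^ 2 + (w ^ 2) ^ 2 + (w ^ 2) ^ 3 + (w ^ 2) ^ 4 = 0 := by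
    linear_combination hw + (w + w ^ 3) * h5
  have hq2 := pow_lt hq (n := 2) (by norm_num)
  have n2 := eu_norm hw2 hq2
  have p5 := eu_ne_zero (pow_lt hq (n := 5) (by norm_num))
  have p25 := eu_ne_zero (pow_lt hq (n := 25) (by norm_num))
  have p10 := eu_ne_zero (pow_lt hq (n := 10) (by norm_num))
  have p50 := eu_ne_zero (pow_lt hq (n := 50) (by norm_num))
  unfold psi
  simp only [mul_pow, ← pow_mul] at n1 n2 ⊢
  norm_num at n1 n2 ⊢
  have e : ∀ x0 x1 x2 x3 x4 y0 y1 y2 y3 y4 : ℂ,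
      x0 ^ 2 / y0 * (x1 ^ 2 / y1) * (x2 ^ 2 / y2) * (x3 ^ 2 / y3) * (x4 ^ 2 / y4)
      = (x0 * x1 * x2 * x3 * x4) ^ 2 / (y0 * y1 * y2 * y3 * y4) := by
    intros; simp only [div_mul_div_comm]; ring
  rw [e, n1, n2]
  field_simp

lemma psi_dissect {w : ℂ} (hw : 1 + w + w ^ 2 + w ^ 3 + w ^ 4 = 0) {r : ℂ} (hr : ‖r‖ < 1)
    (hr0 : r ≠ 0) :
    1 / psi r + w ^ 3 / psi (w * r) + w / psi (w ^ 2 * r) + w ^ 4 / psi (w ^ 3 * r)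
      + w ^ 2 / psi (w ^ 4 * r)
    = 5 * r ^ 2 * (psi (r ^ 25) / psi (r ^ 5) ^ 6 * (psi (r ^ 5) ^ 4
      - 5 * r ^ 5 * psi (r ^ 5) ^ 2 * psi (r ^ 25) ^ 2 + 5 * r ^ 10 * psi (r ^ 25) ^ 4)) := by
  have h5 : w ^ 5 = 1 := by linear_combination (w - 1) * hw
  have hwn : ‖w‖ = 1 := by
    have := congrArg norm h5
    rw [norm_pow, norm_one] at this
    exact (pow_eq_one_iff_of_nonneg (norm_nonneg _) (by norm_num)).1 this
  have hw0 : w ≠ 0 := by rintro rfl; norm_num at h5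
  obtain ⟨P, hPq⟩ := IsAlgClosed.exists_pow_nat_eq r (show 0 < 8 by norm_num)
  have hP0 : P ≠ 0 := by rintro rfl; apply hr0; rw [← hPq]; norm_num
  have hP : ‖P‖ < 1 := by
    rw [← hPq, norm_pow] at hr
    exact (pow_lt_one_iff_of_nonneg (norm_nonneg _) (by norm_num)).1 hr
  have hsq := th_sq 0 hP hP0
  rw [th_zero (pow_lt hP (by norm_num)) (pow_ne_zero _ hP0)] at hsq
  have ha := thr_zero 0 P
  rw [th_zero (pow_lt hP (by norm_num)) (pow_ne_zero _ hP0)] at ha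
  rw [← pow_mul, show P ^ (5 * 8) = r ^ 5 by rw [← hPq]; ring] at hsq
  rw [← pow_mul, show P ^ (25 * 8) = r ^ 25 by rw [← hPq]; ring] at ha
  have T : ∀ j : ℕ, 2 * (w ^ j * P) * psi (w ^ (8 * j) * r)
      = thr 0 P 0 + w ^ j * (2 * thr 0 P 1) + w ^ (4 * j) * (2 * thr 0 P 2) := by
    intro j
    have hn : ‖w ^ j * P‖ < 1 := by rw [norm_mul, norm_pow, hwn]; simpa using hP
    have hne : w ^ j * P ≠ 0 := mul_ne_zero (pow_ne_zero _ hw0) hP0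
    obtain ⟨r0, r1, r2⟩ := thr_rot 0 P (ζ := w ^ j) (by rw [← pow_mul, mul_comm, pow_mul, h5, one_pow])
    have := th_split 0 hn hne
    rw [th_zero hn hne, r0, r1, r2, mul_pow, ← pow_mul, ← pow_mul, hPq, mul_comm j 8,
      mul_comm j 4] at this
    rw [this]; ring
  have T0 := T 0
  have T1 := T 1
  have T2 := T 2
  have T3 := T 3
  have T4 := T 4
  simp only [mul_zero, pow_zero, one_mul, mul_one] at T0
  norm_num at T1 T2 T3 T4
  rw [show w ^ 8 = w ^ 3 by linear_combination w ^ 3 * h5] at T1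
  rw [show w ^ 16 = w by linear_combination (w ^ 11 + w ^ 6 + w) * h5,
    show w ^ 8 = w ^ 3 by linear_combination w ^ 3 * h5] at T2
  rw [show w ^ 24 = w ^ 4 by linear_combination (w ^ 19 + w ^ 14 + w ^ 9 + w ^ 4) * h5,
    show w ^ 12 = w ^ 2 by linear_combination (w ^ 7 + w ^ 2) * h5] at T3
  rw [show w ^ 32 = w ^ 2 by
      linear_combination (w ^ 27 + w ^ 22 + w ^ 17 + w ^ 12 + w ^ 7 + w ^ 2) * h5,
    show w ^ 16 = w by linear_combination (w ^ 11 + w ^ 6 + w) * h5] at T4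
  have E := e4_ident _ _ _ w hw T0 T1 T2 T3 T4
  have N := psi_norm hw hr
  have nz : ∀ j : ℕ, psi (w ^ j * r) ≠ 0 := fun j =>
    psi_ne_zero (by rw [norm_mul, norm_pow, hwn]; simpa using hr)
  have y0 := nz 0
  have y1 := nz 1
  have y2 := nz 2
  have y3 := nz 3
  have y4 := nz 4
  rw [pow_zero, one_mul] at y0
  rw [pow_one] at y1
  have n5 := psi_ne_zero (pow_lt hr (n := 5) (by norm_num))
  have n25 := psi_ne_zero (pow_lt hr (n := 25) (by norm_num))
  have hbc : 2 * thr 0 P 1 * (2 * thr 0 P 2) = (2 * P ^ 5 * psi (r ^ 5)) ^ 2 - (2 * P ^ 25 * psi (r ^ 25)) ^ 2 := by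
    rw [ha] at hsq
    linear_combination -hsq
  rw [ha] at E
  clear T0 T1 T2 T3 T4 T nz ha hsq
  rw [eq_div_iff n25] at N
  generalize psi r = z0 at *
  generalize psi (w * r) = z1 at *
  generalize psi (w ^ 2 * r) = z2 at *
  generalize psi (w ^ 3 * r) = z3 at *
  generalize psi (w ^ 4 * r) = z4 at *
  generalize psi (r ^ 5) = f at *
  generalize psi (r ^ 25) = g at *
  have E2 : 16 * P ^ 4 * (z1 * z2 * z3 * z4 + w ^ 3 * (z0 * z2 * z3 * z4) + w * (z0 * z1 * z3 * z4)
      + w ^ 4 * (z0 * z1 * z2 * z4) + w ^ 2 * (z0 * z1 * z2 * z3))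
      = 16 * P ^ 4 * (5 * r ^ 2 * (f ^ 4 - 5 * r ^ 5 * f ^ 2 * g ^ 2 + 5 * r ^ 10 * g ^ 4)) := by
    have E' : 5 * ((2 * P ^ 25 * g) ^ 4 - 3 * (2 * P ^ 25 * g) ^ 2 * (2 * thr 0 P 1) * (2 * thr 0 P 2)
        + (2 * thr 0 P 1) ^ 2 * (2 * thr 0 P 2) ^ 2)
        = 16 * P ^ 4 * (5 * r ^ 2 * (f ^ 4 - 5 * r ^ 5 * f ^ 2 * g ^ 2 + 5 * r ^ 10 * g ^ 4)) := by
      rw [← hPq]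
      linear_combination 5 * (- 3 * (2 * P ^ 25 * g) ^ 2 + 2 * thr 0 P 1 * (2 * thr 0 P 2) +
        (2 * P ^ 5 * f) ^ 2 - (2 * P ^ 25 * g) ^ 2) * hbc
    rw [← E', ← E]
    have h10 : w ^ 10 = 1 := by linear_combination (w ^ 5 + 1) * h5
    have h9 : w ^ 9 = w ^ 4 := by linear_combination (w ^ 4) * h5
    have h8 : w ^ 8 = w ^ 3 := by linear_combination (w ^ 3) * h5
    have h7 : w ^ 7 = w ^ 2 := by linear_combination (w ^ 2) * h5
    have h6 : w ^ 6 = w := by linear_combination w * h5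
    linear_combination (-16 * P ^ 4) * (z1 * z2 * z3 * z4 * h10 + z0 * z2 * z3 * z4 * h8
      + z0 * z1 * z3 * z4 * h6 + z0 * z1 * z2 * z4 * h9 + z0 * z1 * z2 * z3 * h7)
  have E3 := mul_left_cancel₀ (mul_ne_zero (by norm_num) (pow_ne_zero 4 hP0)) E2
  have L : 1 / z0 + w ^ 3 / z1 + w / z2 + w ^ 4 / z3 + w ^ 2 / z4 =
      (z1 * z2 * z3 * z4 + w ^ 3 * (z0 * z2 * z3 * z4) + w * (z0 * z1 * z3 * z4)
      + w ^ 4 * (z0 * z1 * z2 * z4) + w ^ 2 * (z0 * z1 * z2 * z3)) / (z0 * z1 * z2 * z3 * z4) := by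
    field_simp
  have hN : z0 * z1 * z2 * z3 * z4 = f ^ 6 / g := by rw [← N]; field_simp
  rw [L, E3, hN]
  field_simp

lemma alg_core (q e1 e2 e4 e5 e10 e20 : ℂ) (h1 : e1 ≠ 0) (h2 : e2 ≠ 0) (h4 : e4 ≠ 0)
    (h5 : e5 ≠ 0) (h10 : e10 ≠ 0) (h20 : e20 ≠ 0)
    (R1 : e2 ^ 4 * e5 ^ 2 * e10 = e1 * e2 * e5 ^ 5 + q * e1 ^ 2 * e10 ^ 5)
    (R2 : e1 * e4 * e10 ^ 10 = q * e2 ^ 2 * e5 ^ 5 * e20 ^ 5 + e1 ^ 2 * e4 ^ 2 * e5 ^ 3 * e10 ^ 2 * e20 ^ 3)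
    (R3 : e4 ^ 4 * e10 ^ 2 * e20 = e2 * e4 * e10 ^ 5 + q ^ 2 * e2 ^ 2 * e20 ^ 5)
    (R4 : e2 ^ 10 * e5 ^ 4 * e20 ^ 4 = 4 * q * e1 ^ 3 * e2 ^ 2 * e4 ^ 3 * e5 ^ 5 * e20 ^ 5
      + e1 ^ 4 * e4 ^ 4 * e10 ^ 10)
    (s t s' t' : ℂ) (hs : s = e1 * e4 / e2) (ht : t = e5 * e20 / e10)
    (hs' : s' = e2 ^ 2 / e1) (ht' : t' = e10 ^ 2 / e5) :
    4 * q * ((t / s * (s ^ 4 + 5 * q * s ^ 2 * t ^ 2 + 5 * q ^ 2 * t ^ 4))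
      + (t' / s' * (s' ^ 4 - 5 * q * s' ^ 2 * t' ^ 2 + 5 * q ^ 2 * t' ^ 4)))
    = e5 ^ 10 * e2 / (e10 ^ 5 * e1 ^ 2)
      - e10 ^ 25 * e1 ^ 2 * e4 ^ 2 / (e2 ^ 5 * e5 ^ 10 * e20 ^ 10)
      + 2 * q * (e5 ^ 5 / e1 + e10 ^ 15 * e1 * e4 / (e5 ^ 5 * e20 ^ 5 * e2 ^ 3)) := by
  obtain ⟨F, hF⟩ : ∃ F, F = e5 ^ 10 * e2 / (e10 ^ 5 * e1 ^ 2) := ⟨_, rfl⟩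
  obtain ⟨X, hX⟩ : ∃ X, X = e10 ^ 15 * e1 ^ 2 * e4 / (e5 ^ 10 * e20 ^ 5 * e2 ^ 3) := ⟨_, rfl⟩
  obtain ⟨Y, hY⟩ : ∃ Y, Y = q * (e10 ^ 5 * e1) / (e5 ^ 5 * e2) := ⟨_, rfl⟩
  obtain ⟨W, hW⟩ : ∃ W, W = e1 ^ 3 * e4 ^ 2 * e10 ^ 7 / (e5 ^ 7 * e20 ^ 2 * e2 ^ 3) := ⟨_, rfl⟩
  obtain ⟨V, hV⟩ : ∃ V, V = e2 ^ 3 * e10 / (e1 * e5 ^ 3) := ⟨_, rfl⟩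
  obtain ⟨S, hS⟩ : ∃ S, S = e2 ^ 7 * e10 ^ 5 / (e1 ^ 2 * e4 ^ 3 * e5 ^ 6 * e20) := ⟨_, rfl⟩
  obtain ⟨R, hR⟩ : ∃ R, R = e4 ^ 4 * e10 ^ 12 * e1 ^ 2 / (e5 ^ 10 * e20 ^ 4 * e2 ^ 4) := ⟨_, rfl⟩
  have hX0 : X ≠ 0 := by rw [hX]; positivity
  have k1 : V = 1 + Y := by
    have : V = e2 ^ 4 * e5 ^ 2 * e10 / (e1 * e2 * e5 ^ 5) := by rw [hV]; field_simp
    rw [this, R1, hY]; field_simp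
  have k2 : W = X - Y := by
    have : W = (e1 ^ 2 * e4 ^ 2 * e5 ^ 3 * e10 ^ 2 * e20 ^ 3) *
        (e10 ^ 5 * e1 / (e5 ^ 10 * e20 ^ 5 * e2 ^ 3)) := by rw [hW]; field_simp
    have R2' : e1 ^ 2 * e4 ^ 2 * e5 ^ 3 * e10 ^ 2 * e20 ^ 3
      = e1 * e4 * e10 ^ 10 - q * e2 ^ 2 * e5 ^ 5 * e20 ^ 5 := by linear_combination -R2
    rw [this, R2', hY, hX]; field_simp
  have k3 : R = X + Y ^ 2 := by
    have : R = (e4 ^ 4 * e10 ^ 2 * e20) * (e10 ^ 10 * e1 ^ 2 / (e5 ^ 10 * e20 ^ 5 * e2 ^ 4)) := by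
      rw [hR]; field_simp
    rw [this, R3, hY, hX]; field_simp
  have k4 : S = X + 4 * Y := by
    have : S = (e2 ^ 10 * e5 ^ 4 * e20 ^ 4) *
        (e10 ^ 5 / (e1 ^ 2 * e4 ^ 3 * e5 ^ 10 * e20 ^ 5 * e2 ^ 3)) := by
      rw [hS]; field_simp
    rw [this, R4, hY, hX]; field_simp; ring
  have k5 : V ^ 2 * X = S * R := by rw [hV, hX, hS, hR]; field_simp
  have m1 : q * (s ^ 3 * t) = F * (Y * W ^ 2 / X) := by
    rw [hs, ht, hF, hY, hW, hX]; field_simp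
  have m2 : q ^ 2 * (s * t ^ 3) = F * (Y ^ 2 * W / X) := by
    rw [hs, ht, hF, hY, hW, hX]; field_simp
  have m3 : q ^ 3 * (t ^ 5 / s) = F * (Y ^ 3 / X) := by
    rw [hs, ht, hF, hY, hX]; field_simp
  have m4 : q * (s' ^ 3 * t') = F * (Y * V ^ 2) := by
    rw [hs', ht', hF, hY, hV]; field_simp
  have m5 : q ^ 2 * (s' * t' ^ 3) = F * (Y ^ 2 * V) := by
    rw [hs', ht', hF, hY, hV]; field_simp
  have m6 : q ^ 3 * (t' ^ 5 / s') = F * Y ^ 3 := by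
    rw [hs', ht', hF, hY]; field_simp
  have m7 : e10 ^ 25 * e1 ^ 2 * e4 ^ 2 / (e2 ^ 5 * e5 ^ 10 * e20 ^ 10) = F * X ^ 2 := by
    rw [hF, hX]; field_simp
  have m8 : q * (e5 ^ 5 / e1) = F * Y := by rw [hF, hY]; field_simp
  have m9 : q * (e10 ^ 15 * e1 * e4 / (e5 ^ 5 * e20 ^ 5 * e2 ^ 3)) = F * (X * Y) := by
    rw [hF, hX, hY]; field_simp
  have hs0 : s ≠ 0 := by rw [hs]; positivity
  have hs0' : s' ≠ 0 := by rw [hs']; positivity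
  have g1 : t / s * (s ^ 4 + 5 * q * s ^ 2 * t ^ 2 + 5 * q ^ 2 * t ^ 4)
      = s ^ 3 * t + 5 * q * (s * t ^ 3) + 5 * q ^ 2 * (t ^ 5 / s) := by field_simp
  have g2 : t' / s' * (s' ^ 4 - 5 * q * s' ^ 2 * t' ^ 2 + 5 * q ^ 2 * t' ^ 4)
      = s' ^ 3 * t' - 5 * q * (s' * t' ^ 3) + 5 * q ^ 2 * (t' ^ 5 / s') := by field_simp
  have cub : X * (1 - X) = 2 * X * Y + 4 * Y ^ 3 := by
    rw [k1, k3, k4] at k5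
    linear_combination k5
  have fin : 4 * (Y * W ^ 2 / X) + 20 * (Y ^ 2 * W / X) + 20 * (Y ^ 3 / X) + 4 * (Y * V ^ 2)
      - 20 * (Y ^ 2 * V) + 20 * Y ^ 3 = 1 - X ^ 2 + 2 * Y + 2 * (X * Y) := by
    rw [k1, k2]
    field_simp
    linear_combination (-(1 + X)) * cub
  rw [g1, g2, m7, ← hF]
  linear_combination 4 * m1 + 20 * m2 + 20 * m3 + 4 * m4 - 20 * m5 + 20 * m6 - 2 * m8 - 2 * m9
    + F * fin

lemma psi_neg {q : ℂ} (hq : ‖q‖ < 1) : psi (-q) = eu q * eu (q ^ 4) / eu (q ^ 2) := by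
  have n1 := eu_ne_zero hq
  have n2 := eu_ne_zero (pow_lt hq (n := 2) (by norm_num))
  have n4 := eu_ne_zero (pow_lt hq (n := 4) (by norm_num))
  unfold psi
  rw [eu_neg hq, neg_sq]
  field_simp

lemma psiNeg_eq {q : ℂ} (hq : ‖q‖ < 1) : psiNeg q = psi (-q) := by
  rw [psi_neg hq]; unfold psiNeg; simp only [qpoch_eq_eu]

lemma main_ident {q : ℂ} (hq : ‖q‖ < 1) (hq0 : q ≠ 0) :
    4 * q * ((psi (-q ^ 5) / psi (-q) * (psi (-q) ^ 4 + 5 * q * psi (-q) ^ 2 * psi (-q ^ 5) ^ 2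
        + 5 * q ^ 2 * psi (-q ^ 5) ^ 4))
      + (psi (q ^ 5) / psi q * (psi q ^ 4 - 5 * q * psi q ^ 2 * psi (q ^ 5) ^ 2
        + 5 * q ^ 2 * psi (q ^ 5) ^ 4)))
    = phiNeg (q ^ 5) ^ 5 / phiNeg q - phiNeg ((-q) ^ 5) ^ 5 / phiNeg (-q)
      + 2 * q * (qpoch (q ^ 5) (q ^ 5) ^ 5 / qpoch q q
        + qpoch ((-q) ^ 5) ((-q) ^ 5) ^ 5 / qpoch (-q) (-q)) := by
  have hqn : ‖-q‖ < 1 := by rwa [norm_neg]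
  have hp := fun n (h : n ≠ 0) => pow_lt hq (n := n) h
  have n1 := eu_ne_zero hq
  have n2 := eu_ne_zero (hp 2 (by norm_num))
  have n4 := eu_ne_zero (hp 4 (by norm_num))
  have n5 := eu_ne_zero (hp 5 (by norm_num))
  have n10 := eu_ne_zero (hp 10 (by norm_num))
  have n20 := eu_ne_zero (hp 20 (by norm_num))
  have K1 := identK1 hq hq0
  have K2 := identK1 hqn (neg_ne_zero.2 hq0)
  have K3 := identK1 (hp 2 (by norm_num)) (pow_ne_zero 2 hq0)
  have K4 := identK2 hq hq0
  have s5 := psi_neg (hp 5 (by norm_num))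
  have v5 := eu_neg (hp 5 (by norm_num))
  have s1 := psi_neg hq
  have v1 := eu_neg hq
  have o5 : (-q) ^ 5 = - q ^ 5 := by ring
  have o2 : (-q) ^ 2 = q ^ 2 := by ring
  have o10 : (-q) ^ 10 = q ^ 10 := by ring
  have oo : (- q ^ 5) ^ 2 = q ^ 10 := by ring
  rw [← pow_mul, ← pow_mul] at s5 v5
  norm_num only at s5 v5
  rw [o5, o2, o10, s5, s1, v1, v5] at K2
  have u1 : psi q = eu (q ^ 2) ^ 2 / eu q := rfl
  have u5 : psi (q ^ 5) = eu (q ^ 10) ^ 2 / eu (q ^ 5) := by unfold psi; rw [← pow_mul]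
  have u2 : psi (q ^ 2) = eu (q ^ 4) ^ 2 / eu (q ^ 2) := by unfold psi; rw [← pow_mul]
  have u10 : psi ((q ^ 2) ^ 5) = eu (q ^ 20) ^ 2 / eu (q ^ 10) := by
    unfold psi; simp only [← pow_mul]
  have w1 : phi q = eu (q ^ 2) ^ 5 / (eu q ^ 2 * eu (q ^ 4) ^ 2) := rfl
  have w5 : phi (q ^ 5) = eu (q ^ 10) ^ 5 / (eu (q ^ 5) ^ 2 * eu (q ^ 20) ^ 2) := by
    unfold phi; simp only [← pow_mul]
  rw [u1, u5] at K1
  rw [u2, u10] at K3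
  simp only [← pow_mul] at K3
  norm_num only at K3
  rw [w1, w5] at K4
  unfold phiNeg
  simp only [qpoch_eq_eu]
  simp only [o5, o2, oo, v5, v1, ← pow_mul]
  norm_num only
  have core := alg_core q _ _ _ _ _ _ n1 n2 n4 n5 n10 n20
    (by field_simp at K1; linear_combination K1)
    (by field_simp at K2; linear_combination -K2)
    (by field_simp at K3; linear_combination K3)
    (by field_simp at K4; linear_combination K4)
    _ _ _ _ s1 s5 u1 u5
  rw [core]
  field_simp

lemma coeff_zero (F : ℕ → ℂ) (h : ∀ q : ℂ, ‖q‖ < 1 → HasSum (fun n => F n * q ^ n) 0) (n : ℕ) :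
    F n = 0 := by
  have hp : HasFPowerSeriesAt (0 : ℂ → ℂ) (FormalMultilinearSeries.ofScalars ℂ F) 0 := by
    rw [hasFPowerSeriesAt_iff]
    filter_upwards [Metric.ball_mem_nhds (0 : ℂ) one_pos] with z hz
    have := h z (by simpa using hz)
    simpa [FormalMultilinearSeries.coeff_ofScalars, mul_comm] using this
  have := hp.eq_zero
  have h2 : (FormalMultilinearSeries.ofScalars ℂ F).coeff n = 0 := by rw [this]; rfl
  rwa [FormalMultilinearSeries.coeff_ofScalars] at h2

lemma hasSum_of_ne {f : ℕ → ℂ} {x : ℂ} (h : ∑' n, f n = x) (hx : x ≠ 0) : HasSum f x := by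
  have hs : Summable f := by
    by_contra hn
    rw [tsum_eq_zero_of_not_summable hn] at h
    exact hx h.symm
  rw [← h]; exact hs.hasSum

lemma qpoch_ne {q : ℂ} (hq : ‖q‖ < 1) : qpoch q q ≠ 0 := by
  rw [qpoch_eq_eu]; exact eu_ne_zero hq

lemma phiNeg_ne {q : ℂ} (hq : ‖q‖ < 1) : phiNeg q ≠ 0 :=
  div_ne_zero (pow_ne_zero _ (qpoch_ne hq)) (qpoch_ne (pow_lt hq (by norm_num)))

lemma psiNeg_ne {q : ℂ} (hq : ‖q‖ < 1) : psiNeg q ≠ 0 :=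
  div_ne_zero (mul_ne_zero (qpoch_ne hq) (qpoch_ne (pow_lt hq (by norm_num))))
    (qpoch_ne (pow_lt hq (by norm_num)))

lemma weight {w : ℂ} (hw : 1 + w + w ^ 2 + w ^ 3 + w ^ 4 = 0) (n : ℕ) :
    1 + w ^ 3 * w ^ n + w * (w ^ 2) ^ n + w ^ 4 * (w ^ 3) ^ n + w ^ 2 * (w ^ 4) ^ n
      = if n % 5 = 2 then 5 else 0 := by
  have h5 : w ^ 5 = 1 := by linear_combination (w - 1) * hw
  have key : ∀ j : ℕ, (w ^ j) ^ n = (w ^ j) ^ (n % 5) := by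
    intro j
    conv_lhs => rw [← Nat.div_add_mod n 5]
    rw [pow_add, pow_mul, ← pow_mul w j 5, mul_comm j 5, pow_mul, h5, one_pow, one_pow, one_mul]
  have k1 := key 1
  rw [pow_one] at k1
  rw [k1, key 2, key 3, key 4]
  have hlt : n % 5 < 5 := Nat.mod_lt _ (by norm_num)
  have h6 : w ^ 6 = w := by linear_combination w * h5
  have h7 : w ^ 7 = w ^ 2 := by linear_combination w ^ 2 * h5
  have h8 : w ^ 8 = w ^ 3 := by linear_combination w ^ 3 * h5
  have h9 : w ^ 9 = w ^ 4 := by linear_combination w ^ 4 * h5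
  have h10 : w ^ 10 = 1 := by linear_combination (w ^ 5 + 1) * h5
  have h13 : w ^ 13 = w ^ 3 := by linear_combination (w ^ 8 + w ^ 3) * h5
  have h14 : w ^ 14 = w ^ 4 := by linear_combination (w ^ 9 + w ^ 4) * h5
  have h16 : w ^ 16 = w := by linear_combination (w ^ 11 + w ^ 6 + w) * h5
  have h18 : w ^ 18 = w ^ 3 := by linear_combination (w ^ 13 + w ^ 8 + w ^ 3) * h5
  generalize n % 5 = m at *
  interval_cases m <;> norm_num <;> ring_nf <;> (try simp only [h5, h6, h7, h8, h9, h10, h13, h14, h16, h18])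
    <;> (try norm_num) <;> (try linear_combination hw)

lemma hasSum_G (b : ℕ → ℤ) (hb : ∀ q : ℂ, ‖q‖ < 1 →
      ∑' n : ℕ, (b n : ℂ) * q ^ n = psiNeg (q ^ 5) ^ 5 / psiNeg q) {q : ℂ} (hq : ‖q‖ < 1)
    (hq0 : q ≠ 0) :
    HasSum (fun n : ℕ => (b (5 * n + 2) : ℂ) * q ^ n)
      (psi (-q ^ 5) / psi (-q) * (psi (-q) ^ 4 + 5 * q * psi (-q) ^ 2 * psi (-q ^ 5) ^ 2
        + 5 * q ^ 2 * psi (-q ^ 5) ^ 4)) := by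
  obtain ⟨w, hw⟩ : ∃ w : ℂ, 1 + w + w ^ 2 + w ^ 3 + w ^ 4 = 0 := by
    have hp := Complex.isPrimitiveRoot_exp 5 (by norm_num)
    refine ⟨Complex.exp (2 * Real.pi * Complex.I / (5 : ℕ)), ?_⟩
    have := hp.geom_sum_eq_zero (by norm_num)
    simpa [Finset.sum_range_succ] using this
  have h5 : w ^ 5 = 1 := by linear_combination (w - 1) * hw
  have hwn : ‖w‖ = 1 := by
    have := congrArg norm h5
    rw [norm_pow, norm_one] at this
    exact (pow_eq_one_iff_of_nonneg (norm_nonneg _) (by norm_num)).1 this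
  obtain ⟨r, hrq⟩ := IsAlgClosed.exists_pow_nat_eq q (show 0 < 5 by norm_num)
  have hr0 : r ≠ 0 := by rintro rfl; apply hq0; rw [← hrq]; norm_num
  have hr : ‖r‖ < 1 := by
    rw [← hrq, norm_pow] at hq
    exact (pow_lt_one_iff_of_nonneg (norm_nonneg _) (by norm_num)).1 hq
  have hB : ∀ j : ℕ, HasSum (fun n : ℕ => (b n : ℂ) * (w ^ j * r) ^ n)
      (psi (-q) ^ 5 / psi (w ^ j * -r)) := by
    intro j
    have hj : ‖w ^ j * r‖ < 1 := by rw [norm_mul, norm_pow, hwn]; simpa using hr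
    have h := hasSum_of_ne (hb _ hj) (div_ne_zero (pow_ne_zero _ (psiNeg_ne (pow_lt hj (by norm_num))))
      (psiNeg_ne hj))
    rw [psiNeg_eq hj, psiNeg_eq (pow_lt hj (by norm_num)), mul_pow, ← pow_mul, mul_comm j 5, pow_mul,
      h5, one_pow, one_mul, hrq, ← mul_neg] at h
    exact h
  have b0 := hB 0
  have b1 := (hB 1).mul_left (w ^ 3)
  have b2 := (hB 2).mul_left w
  have b3 := (hB 3).mul_left (w ^ 4)
  have b4 := (hB 4).mul_left (w ^ 2)
  have hS := (((b0.add b1).add b2).add b3).add b4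
  have hrn : ‖-r‖ < 1 := by rwa [norm_neg]
  have dis := psi_dissect hw hrn (neg_ne_zero.2 hr0)
  have o5 : (-r) ^ 5 = -q := by rw [← hrq]; ring
  have o10 : (-r) ^ 10 = q ^ 2 := by rw [← hrq]; ring
  have o25 : (-r) ^ 25 = -q ^ 5 := by rw [← hrq]; ring
  rw [o5, o10, o25] at dis
  have inj : Function.Injective (fun n : ℕ => 5 * n + 2) := by
    intro x y h; simp only at h; omega
  have hS2 : HasSum (fun n : ℕ => if n % 5 = 2 then 5 * ((b n : ℂ) * r ^ n) else 0)
      (5 * r ^ 2 * (psi (-q ^ 5) / psi (-q) * (psi (-q) ^ 4 + 5 * q * psi (-q) ^ 2 * psi (-q ^ 5) ^ 2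
        + 5 * q ^ 2 * psi (-q ^ 5) ^ 4))) := by
    have n1 : psi (-q) ≠ 0 := psi_ne_zero (by rwa [norm_neg])
    convert hS using 1
    · ext n
      have := weight hw n
      have e : (b n : ℂ) * (w ^ 0 * r) ^ n + w ^ 3 * ((b n : ℂ) * (w ^ 1 * r) ^ n)
        + w * ((b n : ℂ) * (w ^ 2 * r) ^ n) + w ^ 4 * ((b n : ℂ) * (w ^ 3 * r) ^ n)
        + w ^ 2 * ((b n : ℂ) * (w ^ 4 * r) ^ n) = (b n : ℂ) * r ^ n *
          (1 + w ^ 3 * w ^ n + w * (w ^ 2) ^ n + w ^ 4 * (w ^ 3) ^ n + w ^ 2 * (w ^ 4) ^ n) := by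
        simp only [mul_pow, pow_zero, pow_one, one_pow]; ring
      rw [e, this]
      split_ifs <;> ring
    · rw [pow_zero, one_mul, pow_one]
      have e : psi (-q) ^ 5 / psi (-r) + w ^ 3 * (psi (-q) ^ 5 / psi (w * -r))
          + w * (psi (-q) ^ 5 / psi (w ^ 2 * -r)) + w ^ 4 * (psi (-q) ^ 5 / psi (w ^ 3 * -r))
          + w ^ 2 * (psi (-q) ^ 5 / psi (w ^ 4 * -r)) =
          psi (-q) ^ 5 * (1 / psi (-r) + w ^ 3 / psi (w * -r) + w / psi (w ^ 2 * -r)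
          + w ^ 4 / psi (w ^ 3 * -r) + w ^ 2 / psi (w ^ 4 * -r)) := by ring
      rw [e, dis]
      field_simp
      ring
  rw [← inj.hasSum_iff] at hS2
  · have h := hS2.mul_left (1 / (5 * r ^ 2))
    have hr2 : 5 * r ^ 2 ≠ 0 := mul_ne_zero (by norm_num) (pow_ne_zero _ hr0)
    rw [← mul_assoc, one_div, inv_mul_cancel₀ hr2, one_mul] at h
    have hf : (fun n : ℕ => (b (5 * n + 2) : ℂ) * q ^ n) = fun i => (5 * r ^ 2)⁻¹ *
        ((fun n : ℕ => if n % 5 = 2 then 5 * ((b n : ℂ) * r ^ n) else 0) ∘ fun n => 5 * n + 2) i := by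
      funext n
      have e : (5 * n + 2) % 5 = 2 := by omega
      simp only [Function.comp, e, if_true]
      rw [← hrq, ← pow_mul, pow_add]
      field_simp
    rw [hf]
    exact h
  · intro x hx
    rw [if_neg]
    intro h
    exact hx ⟨x / 5, by simp only; omega⟩

theorem stmt_15 (c a b : ℕ → ℤ)
    (hc : ∀ q : ℂ, ‖q‖ < 1 →
      ∑' n : ℕ, (c n : ℂ) * q ^ n = qpoch (q ^ 5) (q ^ 5) ^ 5 / qpoch q q)
    (ha : ∀ q : ℂ, ‖q‖ < 1 →
      ∑' n : ℕ, (a n : ℂ) * q ^ n = phiNeg (q ^ 5) ^ 5 / phiNeg q)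
    (hb : ∀ q : ℂ, ‖q‖ < 1 →
      ∑' n : ℕ, (b n : ℂ) * q ^ n = psiNeg (q ^ 5) ^ 5 / psiNeg q) :
    ∀ n : ℕ, 4 * b (10 * n + 2) = a (2 * n + 1) + 2 * c (2 * n) := by
  have hA : ∀ q : ℂ, ‖q‖ < 1 → HasSum (fun n : ℕ => (a n : ℂ) * q ^ n) (phiNeg (q ^ 5) ^ 5 / phiNeg q) :=
    fun q hq => hasSum_of_ne (ha q hq) (div_ne_zero
      (pow_ne_zero _ (phiNeg_ne (pow_lt hq (by norm_num)))) (phiNeg_ne hq))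
  have hC : ∀ q : ℂ, ‖q‖ < 1 → HasSum (fun n : ℕ => (c n : ℂ) * q ^ n)
      (qpoch (q ^ 5) (q ^ 5) ^ 5 / qpoch q q) :=
    fun q hq => hasSum_of_ne (hc q hq) (div_ne_zero
      (pow_ne_zero _ (qpoch_ne (pow_lt hq (by norm_num)))) (qpoch_ne hq))
  have key : ∀ q : ℂ, ‖q‖ < 1 → HasSum (fun n : ℕ =>
      (if n = 0 then 0 else (4 * (b (5 * (n - 1) + 2) : ℂ) - a n - 2 * c (n - 1)) *
        (1 + (-1) ^ (n - 1))) * q ^ n) 0 := by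
    intro q hq
    by_cases hq0 : q = 0
    · subst hq0
      convert hasSum_zero using 1
      ext n
      rcases n with _ | n <;> simp
    have hqn : ‖-q‖ < 1 := by rwa [norm_neg]
    have G1 := hasSum_G b hb hq hq0
    have G2 := hasSum_G b hb hqn (neg_ne_zero.2 hq0)
    have M := main_ident hq hq0
    have A := (hA q hq).sub (hA _ hqn)
    rw [← hasSum_nat_add_iff' 1] at A
    simp only [Finset.sum_range_one, pow_zero, sub_self, sub_zero] at A
    have T := (((G1.add G2).mul_left (4 * q)).sub A).sub
      (((hC q hq).add (hC _ hqn)).mul_left (2 * q))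
    rw [← hasSum_nat_add_iff' 1]
    simp only [Finset.sum_range_one, if_true, zero_mul, sub_zero]
    convert T using 1
    · ext n
      rw [if_neg (Nat.succ_ne_zero n), Nat.add_sub_cancel]
      simp only [neg_pow q]
      ring
    · have o5 : -(-q) ^ 5 = q ^ 5 := by ring
      rw [o5, neg_neg]
      linear_combination -M
  intro n
  have h := coeff_zero _ key (2 * n + 1)
  simp only [if_neg (Nat.succ_ne_zero (2 * n)), Nat.add_sub_cancel] at h
  rw [pow_mul, neg_one_sq, one_pow] at h
  have h2 : (4 * (b (5 * (2 * n) + 2) : ℂ) - a (2 * n + 1) - 2 * c (2 * n)) = 0 := by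
    linear_combination h / 2
  rw [show 10 * n + 2 = 5 * (2 * n) + 2 by ring]
  have h3 : ((4 * b (5 * (2 * n) + 2) : ℤ) : ℂ) = ((a (2 * n + 1) + 2 * c (2 * n) : ℤ) : ℂ) := by
    push_cast; linear_combination h2
  exact_mod_cast h3
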